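/- arXiv:1610.03428 — 2 statements merged into one kernel-verified Lean document; each statement's English description precedes it below -/
import Mathlib

section
/- Let t ≥ 1, n ≥ 2, k ≥ 1 be integers, let p ∈ [1,∞) be real, let A₁,…,A_k be t-linear forms on ℝ^n, and set R = ⌈log₂ n⌉. Then E[‖Σ_{i=1}^k ε_i A_i‖_{ℓ_p,…,ℓ_p}] ≤ 2^t · Σ_{r = (r₁,…,r_t) ∈ [R]^t} 2^{−(r₁+⋯+r_t)/p} · E[ max{ (Σ_{i=1}^k ε_i A_i)(x₁,…,x_t) : x_s ∈ C_{2^{r_s}}^n for each s ∈ [t] } ], where ε₁,…,ε_k are independent Rademacher random variables. -/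
/-- Evaluation of a `t`-linear form on `ℝ^n`, given by its coefficient tensor `A`. -/
noncomputable def evalForm {t n : ℕ} (A : (Fin t → Fin n) → ℝ) (x : Fin t → Fin n → ℝ) : ℝ :=
  ∑ z : Fin t → Fin n, A z * ∏ j, x j (z j)

/-- The `ℓ_p` norm of a vector in `ℝ^n`. -/
noncomputable def lpNorm {n : ℕ} (p : ℝ) (x : Fin n → ℝ) : ℝ :=
  (∑ v, |x v| ^ p) ^ (1/p)

/-- The `ℓ_p,…,ℓ_p` norm of a `t`-linear form on `ℝ^n`. -/
noncomputable def formNorm {t n : ℕ} (p : ℝ) (A : (Fin t → Fin n) → ℝ) : ℝ :=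
  sSup {c | ∃ x : Fin t → Fin n → ℝ, (∀ j, x j ≠ 0) ∧
    c = |evalForm A x| / ∏ j, lpNorm p (x j)}

/-- `C_d^n`: the set of `{−1,0,1}`-vectors in `ℝ^n` with exactly `min{d,n}` nonzero
coordinates. -/
def Cball (n d : ℕ) : Set (Fin n → ℝ) :=
  {x | (∀ i, x i = -1 ∨ x i = 0 ∨ x i = 1) ∧ {i | x i ≠ 0}.ncard = min d n}

/-- The multilinear map with coefficient tensor `A`. -/
noncomputable def evalFormMultilinear {t n : ℕ} (A : (Fin t → Fin n) → ℝ) :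
    MultilinearMap ℝ (fun _ : Fin t => Fin n → ℝ) ℝ :=
  ∑ z : Fin t → Fin n, A z •
    (MultilinearMap.mkPiAlgebra ℝ (Fin t) ℝ).compLinearMap (fun j => LinearMap.proj (z j))

theorem evalFormMultilinear_apply {t n : ℕ} (A : (Fin t → Fin n) → ℝ) (x : Fin t → Fin n → ℝ) :
    evalFormMultilinear A x = evalForm A x := by
  simp [evalFormMultilinear, evalForm]

theorem abs_le_one_of_mem_Cball {n d : ℕ} {x : Fin n → ℝ} (hx : x ∈ Cball n d) (i : Fin n) :
    |x i| ≤ 1 := by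
  rcases hx.1 i with h | h | h <;> simp [h]

theorem bddAbove_evalForm_Cball {t n : ℕ} (A : (Fin t → Fin n) → ℝ) (d : Fin t → ℕ) :
    BddAbove {c | ∃ x : Fin t → Fin n → ℝ, (∀ s, x s ∈ Cball n (d s)) ∧ c = evalForm A x} := by
  refine ⟨∑ z, |A z|, ?_⟩
  rintro c ⟨x, hx, rfl⟩
  refine Finset.sum_le_sum fun z _ => ?_
  refine (le_abs_self _).trans ?_
  rw [abs_mul, Finset.abs_prod]
  exact mul_le_of_le_one_right (abs_nonneg _)
    (Finset.prod_le_one (fun _ _ => abs_nonneg _) fun j _ => abs_le_one_of_mem_Cball (hx j) _)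

/-- A linear functional on a vector with entries in `[-1, 1]` and small support is dominated by
its value at some point of `Cball n d`. -/
theorem exists_mem_Cball_sum_le {n d : ℕ} (f w : Fin n → ℝ) (hw : ∀ i, |w i| ≤ 1)
    (hs : {i | w i ≠ 0}.ncard ≤ min d n) :
    ∃ c ∈ Cball n d, ∑ i, w i * f i ≤ ∑ i, c i * f i := by
  classical
  obtain ⟨S, hS, hcard⟩ := Finset.exists_superset_card_eq
    (s := Finset.univ.filter fun i => w i ≠ 0) (n := min d n)
    (by rw [← Set.ncard_coe_finset]; simpa using hs) (by simp)
  refine ⟨fun i => if i ∈ S then (if 0 ≤ f i then 1 else -1) else 0, ⟨fun i => ?_, ?_⟩, ?_⟩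
  · by_cases h : i ∈ S <;> by_cases h' : 0 ≤ f i <;> simp [h, h']
  · rw [← hcard, ← Set.ncard_coe_finset]
    congr 1
    ext i
    by_cases h : i ∈ S <;> by_cases h' : 0 ≤ f i <;> simp [h, h']
  · refine Finset.sum_le_sum fun i _ => ?_
    have h1 := abs_le.mp (hw i)
    by_cases h : i ∈ S
    · by_cases h' : 0 ≤ f i
      · simp only [h, h', if_true]
        nlinarith
      · simp only [h, h', if_true, if_false]
        nlinarith
    · have : w i = 0 := by
        by_contra h0
        exact h (hS (by simp [h0]))
      simp [h, this]

theorem exists_forall_mem_Cball_evalForm_le {t n : ℕ} (A : (Fin t → Fin n) → ℝ) (d : Fin t → ℕ)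
    (w : Fin t → Fin n → ℝ) (hw : ∀ s i, |w s i| ≤ 1)
    (hs : ∀ s, {i | w s i ≠ 0}.ncard ≤ min (d s) n) :
    ∃ c : Fin t → Fin n → ℝ, (∀ s, c s ∈ Cball n (d s)) ∧ evalForm A w ≤ evalForm A c := by
  classical
  suffices H : ∀ J : Finset (Fin t), ∃ c : Fin t → Fin n → ℝ,
      (∀ s ∈ J, c s ∈ Cball n (d s)) ∧ (∀ s ∉ J, c s = w s) ∧ evalForm A w ≤ evalForm A c by
    obtain ⟨c, hc, -, hle⟩ := H Finset.univ
    exact ⟨c, fun s => hc s (Finset.mem_univ s), hle⟩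
  intro J
  induction J using Finset.induction_on with
  | empty => exact ⟨w, by simp, by simp, le_rfl⟩
  | insert a J ha ih =>
    obtain ⟨c, hc, hcw, hle⟩ := ih
    have hlin : ∀ v : Fin n → ℝ, evalForm A (Function.update c a v) =
        ∑ i, v i * evalForm A (Function.update c a fun j => if i = j then 1 else 0) := by
      intro v
      simpa [evalFormMultilinear_apply] using
        LinearMap.pi_apply_eq_sum_univ ((evalFormMultilinear A).toLinearMap c a) v
    obtain ⟨u, hu, hule⟩ := exists_mem_Cball_sum_le (d := d a)
      (fun i => evalForm A (Function.update c a fun j => if i = j then 1 else 0))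
      (w a) (hw a) (hs a)
    rw [← hlin, ← hlin, ← hcw a ha, Function.update_eq_self] at hule
    refine ⟨Function.update c a u, fun s hs' => ?_, fun s hs' => ?_, hle.trans hule⟩
    · by_cases h : s = a
      · subst h; simpa using hu
      · simpa [h] using hc s (Finset.mem_of_mem_insert_of_ne hs' h)
    · rw [Finset.mem_insert, not_or] at hs'
      simpa [hs'.1] using hcw s hs'.2

theorem lpNorm_pos {n : ℕ} {p : ℝ} {x : Fin n → ℝ} (hx : x ≠ 0) : 0 < lpNorm p x := by
  obtain ⟨i, hi⟩ := Function.ne_iff.mp hx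
  refine Real.rpow_pos_of_pos ?_ _
  exact Finset.sum_pos' (fun _ _ => by positivity)
    ⟨i, Finset.mem_univ i, Real.rpow_pos_of_pos (abs_pos.mpr hi) _⟩

/-- There is an enumeration of the coordinates in which the coordinate at position `m` is at most
`(m + 1) ^ (-1 / p)` times the `ℓ_p` norm. -/
theorem exists_perm_rpow_mul_abs_le_lpNorm {n : ℕ} {p : ℝ} (hp : 1 ≤ p) (x : Fin n → ℝ) :
    ∃ σ : Equiv.Perm (Fin n), ∀ i, (((σ i : ℕ) : ℝ) + 1) ^ (1 / p) * |x i| ≤ lpNorm p x := by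
  have hp0 : 0 < p := by linarith
  set τ := Tuple.sort fun i => -|x i|
  have hmono : Monotone ((fun i => -|x i|) ∘ τ) := Tuple.monotone_sort _
  refine ⟨τ.symm, fun i => ?_⟩
  have hsum : (((τ.symm i : ℕ) : ℝ) + 1) * |x i| ^ p ≤ ∑ v, |x v| ^ p := by
    calc (((τ.symm i : ℕ) : ℝ) + 1) * |x i| ^ p
        = ∑ _j ∈ Finset.Iic (τ.symm i), |x i| ^ p := by simp
      _ ≤ ∑ j ∈ Finset.Iic (τ.symm i), |x (τ j)| ^ p := by
        refine Finset.sum_le_sum fun j hj => ?_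
        have h := hmono (Finset.mem_Iic.mp hj)
        simp only [Function.comp_apply, Equiv.apply_symm_apply, neg_le_neg_iff] at h
        exact Real.rpow_le_rpow (abs_nonneg _) h hp0.le
      _ ≤ ∑ j, |x (τ j)| ^ p :=
        Finset.sum_le_sum_of_subset_of_nonneg (Finset.subset_univ _)
          fun _ _ _ => by positivity
      _ = ∑ v, |x v| ^ p := Equiv.sum_comp τ fun v => |x v| ^ p
  have h := Real.rpow_le_rpow (by positivity) hsum (by positivity : 0 ≤ 1 / p)
  rwa [Real.mul_rpow (by positivity) (by positivity), ← Real.rpow_mul (abs_nonneg _),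
    mul_one_div_cancel hp0.ne', Real.rpow_one] at h

/-- Dyadic decomposition of a vector: the `r`-th piece is supported on at most `2 ^ r` coordinates
and has sup norm at most `2 * 2 ^ (-r / p)` times the `ℓ_p` norm. -/
theorem exists_dyadic_decomposition {n : ℕ} (hn : 2 ≤ n) {p : ℝ} (hp : 1 ≤ p) {x : Fin n → ℝ}
    (hx : x ≠ 0) :
    ∃ w : ℕ → Fin n → ℝ,
      x = ∑ r ∈ Finset.Icc 1 (Nat.clog 2 n), (2 * (2 : ℝ) ^ (-(r : ℝ) / p) * lpNorm p x) • w r ∧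
      (∀ r i, |w r i| ≤ 1) ∧ ∀ r, {i | w r i ≠ 0}.ncard ≤ min (2 ^ r) n := by
  have hp0 : 0 < p := by linarith
  have hN := lpNorm_pos (p := p) hx
  obtain ⟨σ, hσ⟩ := exists_perm_rpow_mul_abs_le_lpNorm hp x
  set M : ℕ → ℝ := fun r => 2 * 2 ^ (-(r : ℝ) / p) * lpNorm p x
  have hMpos : ∀ r, 0 < M r := fun r => by positivity
  refine ⟨fun r i => if Nat.log 2 (σ i) + 1 = r then (M r)⁻¹ * x i else 0, ?_, fun r i => ?_,
    fun r => le_min ?_ ?_⟩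
  · funext i
    have hmem : Nat.log 2 (σ i) + 1 ∈ Finset.Icc 1 (Nat.clog 2 n) := by
      refine Finset.mem_Icc.mpr ⟨by omega, ?_⟩
      have hlt : (σ i : ℕ) < 2 ^ Nat.clog 2 n :=
        (σ i).isLt.trans_le (Nat.le_pow_clog one_lt_two n)
      by_cases h0 : (σ i : ℕ) = 0
      · have := Nat.clog_pos one_lt_two hn
        simp only [h0, Nat.log_zero_right]
        omega
      · exact Nat.log_lt_of_lt_pow h0 hlt
    simp only [Finset.sum_apply, Pi.smul_apply, smul_eq_mul, mul_ite, mul_zero]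
    rw [Finset.sum_ite_eq, if_pos hmem, mul_inv_cancel_left₀ (hMpos _).ne']
  · by_cases h : Nat.log 2 (σ i) + 1 = r
    · simp only [h, if_true]
      rw [abs_mul, abs_of_pos (inv_pos.mpr (hMpos r)), inv_mul_le_one₀ (hMpos r)]
      have hpow : (2 : ℝ) ^ ((r : ℝ) - 1) ≤ ((σ i : ℕ) : ℝ) + 1 := by
        rw [← h]
        push_cast
        rw [add_sub_cancel_right, Real.rpow_natCast]
        by_cases h0 : (σ i : ℕ) = 0
        · simp [h0]
        · have h1 := Nat.pow_log_le_self 2 h0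
          have h2 : ((2 ^ Nat.log 2 (σ i) : ℕ) : ℝ) ≤ ((σ i : ℕ) : ℝ) := by exact_mod_cast h1
          push_cast at h2
          linarith
      have hroot := Real.rpow_le_rpow (by positivity) hpow (by positivity : 0 ≤ 1 / p)
      rw [← Real.rpow_mul zero_le_two] at hroot
      have hle := (mul_le_mul_of_nonneg_right hroot (abs_nonneg (x i))).trans (hσ i)
      have htwo : (2 : ℝ) ^ (1 / p) ≤ 2 := by
        have := Real.rpow_le_rpow_of_exponent_le (one_le_two (α := ℝ))
          ((div_le_one hp0).mpr hp)
        simpa using this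
      calc |x i| = 2 ^ (1 / p) * 2 ^ (-(r : ℝ) / p) * (2 ^ (((r : ℝ) - 1) * (1 / p)) * |x i|) := by
            rw [← mul_assoc, ← Real.rpow_add two_pos, ← Real.rpow_add two_pos]
            have : 1 / p + -(r : ℝ) / p + ((r : ℝ) - 1) * (1 / p) = 0 := by ring
            rw [this, Real.rpow_zero, one_mul]
        _ ≤ 2 * 2 ^ (-(r : ℝ) / p) * lpNorm p x := by gcongr
    · simp [h]
  · have hsub : {i | (if Nat.log 2 (σ i) + 1 = r then (M r)⁻¹ * x i else 0) ≠ 0} ⊆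
        {i | (σ i : ℕ) < 2 ^ r} := by
      intro i hi
      by_cases h : Nat.log 2 (σ i) + 1 = r
      · rw [Set.mem_ofPred_eq, ← h]
        exact Nat.lt_pow_succ_log_self one_lt_two _
      · simp [h] at hi
    refine (Set.ncard_le_ncard hsub).trans ?_
    have := Set.ncard_le_ncard_of_injOn (s := {i | (σ i : ℕ) < 2 ^ r})
      (t := (Finset.range (2 ^ r) : Set ℕ)) (fun i => (σ i : ℕ)) (fun i hi => by simpa using hi)
      (fun i _ j _ hij => σ.injective (Fin.val_injective hij)) (Finset.finite_toSet _)
    rwa [Set.ncard_coe_finset, Finset.card_range] at this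
  · simpa using Set.ncard_le_card {i | (if Nat.log 2 (σ i) + 1 = r then (M r)⁻¹ * x i else 0) ≠ 0}

theorem evalForm_le_sum_dyadic {t n : ℕ} (hn : 2 ≤ n) {p : ℝ} (hp : 1 ≤ p)
    (A : (Fin t → Fin n) → ℝ) {x : Fin t → Fin n → ℝ} (hx : ∀ j, x j ≠ 0) :
    evalForm A x ≤ (2 ^ t *
      ∑ r ∈ Fintype.piFinset (fun _ : Fin t => Finset.Icc 1 (Nat.clog 2 n)),
        (2 : ℝ) ^ (-(∑ s, (r s : ℝ)) / p) *
          sSup {c | ∃ x : Fin t → Fin n → ℝ,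
            (∀ s, x s ∈ Cball n (2 ^ r s)) ∧ c = evalForm A x}) * ∏ j, lpNorm p (x j) := by
  choose w hxw hw hs using fun j => exists_dyadic_decomposition hn hp (hx j)
  have hexpand : evalForm A x =
      ∑ r ∈ Fintype.piFinset (fun _ : Fin t => Finset.Icc 1 (Nat.clog 2 n)),
        (∏ j, (2 * 2 ^ (-(r j : ℝ) / p) * lpNorm p (x j))) *
          evalForm A fun j => w j (r j) := by
    have hfun : x = fun j => ∑ r ∈ Finset.Icc 1 (Nat.clog 2 n),
      (2 * 2 ^ (-(r : ℝ) / p) * lpNorm p (x j)) • w j r := funext hxw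
    conv_lhs => rw [← evalFormMultilinear_apply, hfun, MultilinearMap.map_sum_finset]
    refine Finset.sum_congr rfl fun r _ => ?_
    rw [MultilinearMap.map_smul_univ, evalFormMultilinear_apply, smul_eq_mul]
  rw [hexpand, Finset.mul_sum, Finset.sum_mul]
  refine Finset.sum_le_sum fun r _ => ?_
  obtain ⟨c, hc, hle⟩ := exists_forall_mem_Cball_evalForm_le A (fun j => 2 ^ r j)
    (fun j => w j (r j)) (fun j => hw j (r j)) (fun j => hs j (r j))
  have hsup := hle.trans (le_csSup (bddAbove_evalForm_Cball A fun j => 2 ^ r j) ⟨c, hc, rfl⟩)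
  have hprod : ∏ j, (2 * 2 ^ (-(r j : ℝ) / p) * lpNorm p (x j)) =
      2 ^ t * 2 ^ (-(∑ s, (r s : ℝ)) / p) * ∏ j, lpNorm p (x j) := by
    rw [Finset.prod_mul_distrib, Finset.prod_mul_distrib, Finset.prod_const, Finset.card_univ,
      Fintype.card_fin, ← Real.rpow_sum_of_pos two_pos, ← Finset.sum_div, Finset.sum_neg_distrib]
  have hnonneg : 0 ≤ ∏ j, lpNorm p (x j) := Finset.prod_nonneg fun j _ => (lpNorm_pos (hx j)).le
  rw [hprod]
  refine (mul_le_mul_of_nonneg_left hsup (by positivity)).trans_eq ?_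
  ring

theorem formNorm_le_sum_dyadic {t n : ℕ} (ht : 1 ≤ t) (hn : 2 ≤ n) {p : ℝ} (hp : 1 ≤ p)
    (A : (Fin t → Fin n) → ℝ) :
    formNorm p A ≤ 2 ^ t *
      ∑ r ∈ Fintype.piFinset (fun _ : Fin t => Finset.Icc 1 (Nat.clog 2 n)),
        (2 : ℝ) ^ (-(∑ s, (r s : ℝ)) / p) *
          sSup {c | ∃ x : Fin t → Fin n → ℝ,
            (∀ s, x s ∈ Cball n (2 ^ r s)) ∧ c = evalForm A x} := by
  refine csSup_le ⟨_, fun _ _ => 1, fun _ => Function.ne_iff.mpr ⟨⟨0, by omega⟩, by simp⟩, rfl⟩ ?_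
  rintro c ⟨x, hx, rfl⟩
  rw [div_le_iff₀ (Finset.prod_pos fun j _ => lpNorm_pos (hx j))]
  refine abs_le'.mpr ⟨evalForm_le_sum_dyadic hn hp A hx, ?_⟩
  let a : Fin t := ⟨0, ht⟩
  have hneg : evalForm A (Function.update x a (-x a)) = -evalForm A x := by
    rw [← evalFormMultilinear_apply, MultilinearMap.map_update_neg, Function.update_eq_self,
      evalFormMultilinear_apply]
  have hnorm : ∀ j, lpNorm p (Function.update x a (-x a) j) = lpNorm p (x j) := by
    intro j
    by_cases h : j = a
    · subst h; simp [lpNorm]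
    · simp [h]
  have hx' : ∀ j, Function.update x a (-x a) j ≠ 0 := by
    intro j
    by_cases h : j = a
    · subst h; simpa using hx _
    · simpa [h] using hx j
  have h := evalForm_le_sum_dyadic hn hp A hx'
  simp only [hnorm] at h
  rwa [hneg] at h

/-- dyadic decomposition: for `t, k ≥ 1`, `n ≥ 2`, real `p ≥ 1`,
`t`-linear forms `A₁,…,A_k` on `ℝ^n` and `R = ⌈log₂ n⌉`,
`E_ε[‖Σᵢ εᵢ Aᵢ‖_{ℓ_p,…,ℓ_p}] ≤ 2^t Σ_{r ∈ [R]^t} 2^{−(r₁+⋯+r_t)/p}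
E_ε[max{(Σᵢ εᵢ Aᵢ)(x) : x_s ∈ C_{2^{r_s}}^n}]` (Rademacher expectations written as
averages over `{−1,1}^k`). -/
theorem stmt15 (t n k : ℕ) (ht : 1 ≤ t) (hn : 2 ≤ n) (hk : 1 ≤ k)
    (p : ℝ) (hp : 1 ≤ p) (A : Fin k → ((Fin t → Fin n) → ℝ)) :
    ((2 : ℝ) ^ k)⁻¹ *
        ∑ ε : Fin k → Bool,
          formNorm p (∑ i, (if ε i then (1:ℝ) else -1) • A i)
      ≤ 2 ^ t *
        ∑ r ∈ Fintype.piFinset (fun _ : Fin t => Finset.Icc 1 (Nat.clog 2 n)),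
          (2 : ℝ) ^ (-(∑ s, (r s : ℝ)) / p) *
            (((2 : ℝ) ^ k)⁻¹ *
              ∑ ε : Fin k → Bool,
                sSup {c | ∃ x : Fin t → Fin n → ℝ,
                  (∀ s, x s ∈ Cball n (2 ^ r s)) ∧
                  c = evalForm (∑ i, (if ε i then (1:ℝ) else -1) • A i) x}) := by
  have hle := Finset.sum_le_sum fun (ε : Fin k → Bool) (_ : ε ∈ Finset.univ) =>
    formNorm_le_sum_dyadic ht hn hp (∑ i, (if ε i then (1:ℝ) else -1) • A i)
  refine (mul_le_mul_of_nonneg_left hle (by positivity)).trans_eq ?_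
  rw [← Finset.mul_sum, Finset.sum_comm, mul_left_comm, Finset.mul_sum]
  congr 1
  refine Finset.sum_congr rfl fun r _ => ?_
  rw [← Finset.mul_sum, mul_left_comm]
end

section
/- For every integer t ≥ 3 there exists a constant C(t) ∈ (0,∞) such that the following holds. Let n ≥ 2 and k ≥ 1 be integers, let A₁,…,A_k ∈ Π_n^{(t)}, and let d = (d₁,…,d_t) ∈ [n]^t; write min(d) = min_s d_s and max(d) = max_s d_s. Then E[ max{ (Σ_{i=1}^k ε_i A_i)(x₁,…,x_t) : x_s ∈ C_{d_s}^n for each s ∈ [t] } ] ≤ C(t)·√(k·max(d)·log n)·min(d)^{1 − 1/(2t)}, where ε₁,…,ε_k are independent Rademacher random variables. -/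
/-- Plane sub-stochastic `t`-linear forms on `ℝ^n`. -/
def PlaneSubStochastic {t n : ℕ} (A : (Fin t → Fin n) → ℝ) : Prop :=
  (∀ s, 0 ≤ A s) ∧
  ∀ (j : Fin t) (i : Fin n), (∑ s : Fin t → Fin n, if s j = i then A s else 0) ≤ 1

/-- `Π_n^{(t)}`: forms `A` with `|A|` plane sub-stochastic. -/
def PiSet (t n : ℕ) : Set ((Fin t → Fin n) → ℝ) :=
  {A | PlaneSubStochastic fun s => |A s|}

open Finset
open scoped BigOperators Pointwise

/-- Massart's finite class lemma: a finite set of at most `exp Λ` vectors of Euclidean norm at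
most `σ` has a random upper bound for its Rademacher sums of mean at most `σ √(2Λ)`. -/
lemma exists_rademacher_majorant {k : ℕ} (J : Finset (Fin k → ℝ)) {σ Λ : ℝ} (hσ : 0 < σ)
    (hΛ : 0 < Λ) (hJ : ∀ v ∈ J, ∑ i, v i ^ 2 ≤ σ ^ 2) (hcard : (#J : ℝ) ≤ Real.exp Λ) :
    ∃ G : (Fin k → Bool) → ℝ,
      (∀ ε, ∀ v ∈ J, ∑ i, (if ε i then (1 : ℝ) else -1) * v i ≤ G ε) ∧
      𝔼 ε, G ε ≤ σ * √(2 * Λ) := by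
  set l : ℝ := √(2 * Λ) / σ with hl
  have hl0 : 0 < l := by positivity
  have hsq : l ^ 2 * σ ^ 2 = 2 * Λ := by
    rw [hl, div_pow, Real.sq_sqrt (by positivity)]; field_simp
  set y : (Fin k → Bool) → (Fin k → ℝ) → ℝ :=
    fun ε v => ∑ i, (if ε i then (1 : ℝ) else -1) * v i with hy
  refine ⟨fun ε => (2 * Λ - 1 + ∑ v ∈ J, Real.exp (l * y ε v - 2 * Λ)) / l, ?_, ?_⟩
  · intro ε v hv
    rw [le_div_iff₀ hl0]
    have h1 := Real.add_one_le_exp (l * y ε v - 2 * Λ)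
    have h2 := single_le_sum (f := fun v => Real.exp (l * y ε v - 2 * Λ))
      (fun _ _ => (Real.exp_pos _).le) hv
    simp only [hy] at h1 h2 ⊢
    linarith
  · have hmgf : ∀ v ∈ J, 𝔼 ε, Real.exp (l * y ε v - 2 * Λ) ≤ Real.exp (-Λ) := by
      intro v hv
      have h1 : ∑ ε : Fin k → Bool, Real.exp (l * y ε v) = ∏ i, (2 * Real.cosh (l * v i)) := by
        have : ∀ i, 2 * Real.cosh (l * v i)
            = ∑ b : Bool, Real.exp (l * ((if b then (1 : ℝ) else -1) * v i)) := by
          intro i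
          rw [Real.cosh_eq]; simp; ring
        simp_rw [this]
        rw [Fintype.prod_sum]
        refine sum_congr rfl fun ε _ => ?_
        rw [← Real.exp_sum, hy, mul_sum]
      have h2 : ∏ i, (2 * Real.cosh (l * v i)) ≤ 2 ^ k * Real.exp Λ := by
        calc ∏ i, (2 * Real.cosh (l * v i))
            ≤ ∏ i, (2 * Real.exp ((l * v i) ^ 2 / 2)) := by
              refine prod_le_prod (fun i _ => ?_) (fun i _ => ?_)
              · have := Real.cosh_pos (l * v i); positivity
              · gcongr; exact Real.cosh_le_exp_half_sq _
          _ = 2 ^ k * Real.exp (l ^ 2 * (∑ i, v i ^ 2) / 2) := by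
              rw [prod_mul_distrib, ← Real.exp_sum]
              simp [mul_sum, sum_div, mul_pow]
          _ ≤ 2 ^ k * Real.exp Λ := by
              gcongr
              have := mul_le_mul_of_nonneg_left (hJ v hv) (sq_nonneg l)
              linarith
      rw [Fintype.expect_eq_sum_div_card]
      simp_rw [Real.exp_sub]
      rw [← sum_div, h1]
      have h3 : Real.exp (-Λ) = Real.exp Λ / Real.exp (2 * Λ) := by
        rw [← Real.exp_sub]; ring_nf
      rw [h3, div_right_comm]
      gcongr
      rw [div_le_iff₀ (by positivity)]
      simpa [mul_comm] using h2
    have hsum : ∑ v ∈ J, 𝔼 ε, Real.exp (l * y ε v - 2 * Λ) ≤ 1 := by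
      calc _ ≤ ∑ v ∈ J, Real.exp (-Λ) := sum_le_sum hmgf
        _ = #J * Real.exp (-Λ) := by simp
        _ ≤ Real.exp Λ * Real.exp (-Λ) := by gcongr
        _ = 1 := by rw [← Real.exp_add]; simp
    rw [← expect_div, expect_add_distrib, expect_sum_comm, Fintype.expect_const,
      div_le_iff₀ hl0]
    have : σ * √(2 * Λ) * l = 2 * Λ := by
      rw [hl]; field_simp; exact Real.sq_sqrt (by positivity)
    linarith

/-- The weights of a thinning with retention probability `1 / q`: a coordinate is retained, and
rescaled by `q`, when its uniform label in `Fin q` is `0`. -/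
def thinWeight {ι : Type*} {q : ℕ} [NeZero q] (ω : ι → Fin q) (a : ι) : ℝ :=
  if ω a = 0 then q else 0

lemma expect_prod_thinWeight {ι : Type*} [Fintype ι] [DecidableEq ι] (q : ℕ) [NeZero q]
    (S : Finset ι) : 𝔼 ω : ι → Fin q, ∏ a ∈ S, thinWeight ω a = 1 := by
  have h : ∀ ω : ι → Fin q, ∏ a ∈ S, thinWeight ω a
      = ∏ a, (if a ∈ S then (if ω a = 0 then (q : ℝ) else 0) else 1) := by
    intro ω
    rw [prod_ite_mem]; simp [thinWeight]
  have hq : (q : ℝ) ≠ 0 := by exact_mod_cast NeZero.ne q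
  rw [Fintype.expect_eq_sum_div_card]
  simp_rw [h]
  rw [← Fintype.prod_sum (fun a b => if a ∈ S then (if b = 0 then (q : ℝ) else 0) else 1)]
  have : ∀ a, (∑ b : Fin q, if a ∈ S then (if b = 0 then (q : ℝ) else 0) else 1) = q := by
    intro a; split_ifs <;> simp
  simp_rw [this]
  simp [hq]

lemma thinWeight_mul_self {ι : Type*} {q : ℕ} [NeZero q] (ω : ι → Fin q) (a : ι) :
    thinWeight ω a * thinWeight ω a = q * thinWeight ω a := by
  unfold thinWeight; split_ifs <;> simp

section Thinning

variable {t n q : ℕ} [NeZero q]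

lemma expect_prod_thinWeight_graph (z : Fin t → Fin n) :
    𝔼 ω : Fin t × Fin n → Fin q, ∏ s, thinWeight ω (s, z s) = 1 := by
  rw [← expect_prod_thinWeight q (univ.image fun s => (s, z s))]
  refine expect_congr rfl fun ω _ => ?_
  rw [prod_image]
  intro a _ b _ h
  exact congrArg Prod.fst h

lemma expect_prod_thinWeight_mul_prod (z z' : Fin t → Fin n) :
    𝔼 ω : Fin t × Fin n → Fin q, (∏ s, thinWeight ω (s, z s)) * ∏ s, thinWeight ω (s, z' s)
      = ∏ s, if z s = z' s then (q : ℝ) else 1 := by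
  have h : ∀ ω : Fin t × Fin n → Fin q,
      (∏ s, thinWeight ω (s, z s)) * ∏ s, thinWeight ω (s, z' s)
      = (∏ s, if z s = z' s then (q : ℝ) else 1) *
        ∏ a ∈ univ.biUnion (fun s => ({(s, z s), (s, z' s)} : Finset (Fin t × Fin n))),
          thinWeight ω a := by
    intro ω
    rw [prod_biUnion, ← prod_mul_distrib, ← prod_mul_distrib]
    · refine prod_congr rfl fun s _ => ?_
      split_ifs with hs
      · rw [hs, thinWeight_mul_self]; simp
      · rw [prod_pair (by simpa using hs), one_mul]
    · intro s _ s' _ hss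
      rw [Function.onFun, disjoint_left]
      rintro ⟨a, b⟩ h1 h2
      simp only [mem_insert, mem_singleton, Prod.mk.injEq] at h1 h2
      apply hss
      rcases h1 with h1 | h1 <;> rcases h2 with h2 | h2 <;> exact h1.1.symm.trans h2.1
  simp_rw [h]
  rw [← mul_expect, expect_prod_thinWeight, mul_one]

/-- The thinning of a tuple of vectors. -/
def thin (ω : Fin t × Fin n → Fin q) (x : Fin t → Fin n → ℝ) : Fin t → Fin n → ℝ :=
  fun s i => x s i * thinWeight ω (s, i)

lemma abs_prod_ite_sub_one_le (z z' : Fin t → Fin n) :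
    |(∏ s, if z s = z' s then (q : ℝ) else 1) - 1|
      ≤ (q : ℝ) ^ t * ∑ s, if z s = z' s then (1 : ℝ) else 0 := by
  have hq : (1 : ℝ) ≤ q := by exact_mod_cast NeZero.one_le
  by_cases h : ∃ s, z s = z' s
  · obtain ⟨s, hs⟩ := h
    have h1 : (1 : ℝ) ≤ ∏ s, if z s = z' s then (q : ℝ) else 1 :=
      Finset.one_le_prod fun s _ => by split_ifs <;> simp [hq]
    have h2 : (∏ s, if z s = z' s then (q : ℝ) else 1) ≤ (q : ℝ) ^ t := by
      calc _ ≤ ∏ _s : Fin t, (q : ℝ) := prod_le_prod (fun s _ => by split_ifs <;> positivity)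
            (fun s _ => by split_ifs <;> simp [hq])
        _ = _ := by simp
    have h3 : (1 : ℝ) ≤ ∑ s, if z s = z' s then (1 : ℝ) else 0 := by
      have := single_le_sum (f := fun s => if z s = z' s then (1 : ℝ) else 0)
        (fun s _ => by positivity) (mem_univ s)
      simpa [hs] using this
    rw [abs_of_nonneg (by linarith)]
    nlinarith [pow_pos (zero_lt_one.trans_le hq) t]
  · push Not at h
    simp [h]

/-- The mean square error of thinning. -/
lemma expect_evalForm_thin_sub_sq_le {A : (Fin t → Fin n) → ℝ} (hA : A ∈ PiSet t n)
    {x : Fin t → Fin n → ℝ} (hx : ∀ s i, |x s i| ≤ 1) {D : ℝ}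
    (hD : ∑ z, |A z * ∏ j, x j (z j)| ≤ D) :
    𝔼 ω : Fin t × Fin n → Fin q, (evalForm A (thin ω x) - evalForm A x) ^ 2
      ≤ (q : ℝ) ^ t * t * D := by
  set c : (Fin t → Fin n) → ℝ := fun z => A z * ∏ j, x j (z j) with hc
  set W : (Fin t × Fin n → Fin q) → (Fin t → Fin n) → ℝ :=
    fun ω z => ∏ s, thinWeight ω (s, z s) with hW
  have hcA : ∀ z, |c z| ≤ |A z| := by
    intro z
    rw [hc, abs_mul, abs_prod]
    exact mul_le_of_le_one_right (abs_nonneg _)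
      (prod_le_one (fun _ _ => abs_nonneg _) fun _ _ => hx _ _)
  have hplane : ∀ (s : Fin t) (i : Fin n), (∑ z', if i = z' s then |c z'| else 0) ≤ 1 := by
    intro s i
    refine le_trans (sum_le_sum fun z' _ => ?_) (hA.2 s i)
    by_cases h : z' s = i
    · simp [h, hcA]
    · simp [h, Ne.symm h]
  have hexp : ∀ ω, (evalForm A (thin ω x) - evalForm A x) ^ 2
      = ∑ z, ∑ z', c z * c z' * (W ω z * W ω z' - W ω z - W ω z' + 1) := by
    intro ω
    have : evalForm A (thin ω x) - evalForm A x = ∑ z, c z * (W ω z - 1) := by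
      rw [evalForm, evalForm, ← sum_sub_distrib]
      refine sum_congr rfl fun z _ => ?_
      simp only [thin, prod_mul_distrib, hc, hW]
      ring
    rw [this, sq, sum_mul_sum]
    refine sum_congr rfl fun z _ => sum_congr rfl fun z' _ => ?_
    ring
  simp_rw [hexp]
  rw [expect_sum_comm]
  simp_rw [expect_sum_comm, ← mul_expect, expect_add_distrib, expect_sub_distrib]
  simp only [hW, expect_prod_thinWeight_graph, expect_prod_thinWeight_mul_prod,
    Fintype.expect_const, sub_add_cancel]
  calc _ ≤ ∑ z, ∑ z', |c z| * |c z'| *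
        ((q : ℝ) ^ t * ∑ s, if z s = z' s then (1 : ℝ) else 0) := by
        refine sum_le_sum fun z _ => sum_le_sum fun z' _ => ?_
        refine (le_abs_self _).trans ?_
        rw [abs_mul, abs_mul]
        gcongr
        exact abs_prod_ite_sub_one_le z z'
    _ = (q : ℝ) ^ t * ∑ z, |c z| * ∑ s, ∑ z', if z s = z' s then |c z'| else 0 := by
        simp_rw [mul_sum]
        refine sum_congr rfl fun z _ => ?_
        rw [sum_comm]
        refine sum_congr rfl fun s _ => sum_congr rfl fun z' _ => ?_
        split_ifs <;> ring
    _ ≤ (q : ℝ) ^ t * ∑ z, |c z| * ∑ _s : Fin t, 1 := by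
        gcongr with z _ s _
        exact hplane s (z s)
    _ = (q : ℝ) ^ t * t * ∑ z, |c z| := by
        simp [← sum_mul]; ring
    _ ≤ _ := by gcongr

end Thinning

/-- The vectors with at most one nonzero coordinate, whose value is `± q`. -/
noncomputable def sparseAtoms (n q : ℕ) : Finset (Fin n → ℝ) :=
  image₂ (fun i c => Pi.single i c) univ ({0, (q : ℝ), -(q : ℝ)} : Finset ℝ)

lemma card_sparseAtoms_le (n q : ℕ) : #(sparseAtoms n q) ≤ n * 3 := by
  refine (card_image₂_le _ _ _).trans ?_
  simpa using Nat.mul_le_mul_left n card_le_three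

lemma mem_nsmul_sparseAtoms {n q : ℕ} (hn : 0 < n) (r : ℕ) (y : Fin n → ℝ)
    (hy : ∀ i, y i = 0 ∨ y i = q ∨ y i = -q) (hr : #{i | y i ≠ 0} ≤ r) :
    y ∈ r • sparseAtoms n q := by
  induction r generalizing y with
  | zero =>
    have h : y = 0 := by
      ext i
      by_contra hi
      have : i ∈ ({i | y i ≠ 0} : Finset (Fin n)) := by simpa using hi
      rw [card_eq_zero.mp (Nat.le_zero.mp hr)] at this
      simp at this
    simp [h]
  | succ r ih =>
    rw [succ_nsmul, mem_add]
    by_cases h : ∃ i, y i ≠ 0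
    · obtain ⟨i, hi⟩ := h
      refine ⟨Function.update y i 0, ih _ ?_ ?_, Pi.single i (y i), ?_, ?_⟩
      · intro j
        by_cases hj : j = i
        · simp [hj]
        · simpa [hj] using hy j
      · have hsub : ({j | Function.update y i 0 j ≠ 0} : Finset (Fin n))
            = ({j | y j ≠ 0} : Finset (Fin n)).erase i := by
          ext j
          by_cases hj : j = i <;> simp [hj]
        rw [hsub, card_erase_of_mem (by simpa using hi)]
        omega
      · exact mem_image₂_of_mem (mem_univ _) (by simpa using hy i)
      · ext j
        by_cases hj : j = i
        · subst hj; simp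
        · simp [hj]
    · push Not at h
      refine ⟨0, ih 0 (by simp) (by simp), 0, ?_, ?_⟩
      · exact mem_image₂.mpr ⟨⟨0, hn⟩, mem_univ _, 0, by simp, by simp⟩
      · ext j; simp [h]

/-- A finite set containing all tuples of `r`-sparse vectors with entries in `{0, q, -q}`. -/
noncomputable def sparseNet (t n q r : ℕ) : Finset (Fin t → Fin n → ℝ) :=
  Fintype.piFinset fun _ => r • sparseAtoms n q

lemma card_sparseNet_le {t n q r : ℕ} (hn : 2 ≤ n) :
    (#(sparseNet t n q r) : ℝ) ≤ Real.exp (3 * t * r * Real.log n) := by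
  have h1 : #(sparseNet t n q r) ≤ n ^ (3 * t * r) := by
    rw [sparseNet, Fintype.card_piFinset_const]
    calc #(r • sparseAtoms n q) ^ t ≤ ((n ^ 3) ^ r) ^ t := by
          gcongr
          refine card_nsmul_le.trans ?_
          gcongr
          refine (card_sparseAtoms_le n q).trans ?_
          nlinarith [Nat.mul_le_mul hn hn]
      _ = n ^ (3 * t * r) := by rw [← pow_mul, ← pow_mul]; ring_nf
  have h2 : Real.exp (3 * t * r * Real.log n) = (n : ℝ) ^ (3 * t * r) := by
    rw [← Real.exp_log (by positivity : (0 : ℝ) < (n : ℝ) ^ (3 * t * r)), Real.log_pow]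
    push_cast; rfl
  rw [h2]
  exact_mod_cast h1

/-- Every tuple of sign vectors is approximated by a tuple of sparse vectors. -/
lemma exists_mem_sparseNet_approx {t n k q M : ℕ} (ht : 0 < t) (hn : 0 < n) (hk : 0 < k)
    (hq : 0 < q) (hM : 0 < M) {m : ℝ} (hm : 0 < m) {A : Fin k → ((Fin t → Fin n) → ℝ)}
    (hA : ∀ i, A i ∈ PiSet t n) {x : Fin t → Fin n → ℝ}
    (hx : ∀ s i, x s i = -1 ∨ x s i = 0 ∨ x s i = 1)
    (hxm : ∀ i, ∑ z, |A i z * ∏ j, x j (z j)| ≤ m)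
    (hxM : ∀ s, #{i | x s i ≠ 0} ≤ M) :
    ∃ y ∈ sparseNet t n q (2 * t * M / q),
      ∑ i, (evalForm (A i) y - evalForm (A i) x) ^ 2 ≤ 2 * t * k * m * (q : ℝ) ^ t := by
  have : NeZero q := ⟨hq.ne'⟩
  set err : (Fin t × Fin n → Fin q) → ℝ :=
    fun ω => ∑ i, (evalForm (A i) (thin ω x) - evalForm (A i) x) ^ 2 with herr
  set size : Fin t → (Fin t × Fin n → Fin q) → ℝ :=
    fun s ω => ∑ i with x s i ≠ 0, thinWeight ω (s, i) with hsize
  have hw : ∀ (ω : Fin t × Fin n → Fin q) a, 0 ≤ thinWeight ω a := by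
    intro ω a; unfold thinWeight; positivity
  have hsize0 : ∀ s ω, 0 ≤ size s ω := fun s ω => sum_nonneg fun i _ => hw _ _
  have herr0 : ∀ ω, 0 ≤ err ω := fun ω => sum_nonneg fun i _ => sq_nonneg _
  have hx1 : ∀ s i, |x s i| ≤ 1 := by
    intro s i
    rcases hx s i with h | h | h <;> simp [h]
  have hEerr : 𝔼 ω, err ω ≤ t * k * m * (q : ℝ) ^ t := by
    rw [herr, expect_sum_comm]
    calc _ ≤ ∑ _i : Fin k, (q : ℝ) ^ t * t * m :=
          sum_le_sum fun i _ => expect_evalForm_thin_sub_sq_le (hA i) hx1 (hxm i)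
      _ = _ := by simp; ring
  have hEsize : ∀ s, 𝔼 ω, size s ω ≤ M := by
    intro s
    have h1 : ∀ a : Fin t × Fin n, 𝔼 ω : Fin t × Fin n → Fin q, thinWeight ω a = 1 := by
      intro a
      simpa using expect_prod_thinWeight q ({a} : Finset (Fin t × Fin n))
    simp only [hsize]
    rw [expect_sum_comm]
    simp only [h1]
    simpa using hxM s
  have htot :
      𝔼 ω, (err ω / (2 * t * k * m * (q : ℝ) ^ t) + (∑ s, size s ω) / (2 * t * M)) ≤ 1 := by
    have h1 : (𝔼 ω, err ω) / (2 * t * k * m * (q : ℝ) ^ t) ≤ 1 / 2 := by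
      rw [div_le_iff₀ (by positivity)]; linarith
    have h2 : (∑ s, 𝔼 ω, size s ω) / (2 * t * M) ≤ 1 / 2 := by
      rw [div_le_iff₀ (by positivity)]
      calc _ ≤ ∑ _s : Fin t, (M : ℝ) := sum_le_sum fun s _ => hEsize s
        _ = _ := by simp; ring
    rw [expect_add_distrib, ← expect_div, ← expect_div,
      expect_sum_comm univ univ fun ω s => size s ω]
    linarith
  obtain ⟨ω, -, hω⟩ := exists_le_of_expect_le univ_nonempty htot
  have hd1 : 0 ≤ err ω / (2 * t * k * m * (q : ℝ) ^ t) := div_nonneg (herr0 ω) (by positivity)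
  have hd2 : 0 ≤ (∑ s, size s ω) / (2 * t * M) :=
    div_nonneg (sum_nonneg fun s _ => hsize0 s ω) (by positivity)
  refine ⟨thin ω x, ?_, ?_⟩
  · rw [sparseNet, Fintype.mem_piFinset]
    intro s
    refine mem_nsmul_sparseAtoms hn _ _ ?_ ?_
    · intro i
      unfold thin thinWeight
      split_ifs
      · rcases hx s i with h | h | h <;> simp [h]
      · simp
    · rw [Nat.le_div_iff_mul_le hq]
      have h1 : (∑ s, size s ω) ≤ 2 * t * M := by
        rw [← div_le_one (by positivity)]; linarith
      have h2 : size s ω ≤ 2 * t * M :=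
        (single_le_sum (f := fun s => size s ω) (fun s _ => hsize0 s ω) (mem_univ s)).trans h1
      have h3 : size s ω = (#{i | thin ω x s i ≠ 0} : ℝ) * q := by
        simp only [hsize, thinWeight]
        rw [← sum_filter, filter_filter, sum_const, nsmul_eq_mul]
        congr 3
        ext i
        simp [thin, thinWeight, hq.ne', and_comm]
      rw [h3] at h2
      exact_mod_cast h2
  · rw [← div_le_one (by positivity)]
    linarith

lemma evalForm_sum_smul {t n k : ℕ} (c : Fin k → ℝ) (A : Fin k → ((Fin t → Fin n) → ℝ))
    (x : Fin t → Fin n → ℝ) :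
    evalForm (∑ i, c i • A i) x = ∑ i, c i * evalForm (A i) x := by
  simp only [evalForm, Finset.sum_apply, Pi.smul_apply, smul_eq_mul, sum_mul, mul_sum]
  rw [sum_comm]
  simp only [mul_assoc]

lemma card_support_of_mem_Cball {n d : ℕ} (hd : d ≤ n) {x : Fin n → ℝ} (hx : x ∈ Cball n d) :
    #{i | x i ≠ 0} = d := by
  have h := hx.2
  rw [Set.ncard_eq_toFinset_card', min_eq_left hd] at h
  rw [← h]
  congr 1
  ext i; simp

lemma Cball_nonempty {n d : ℕ} (hd : d ≤ n) : (Cball n d).Nonempty := by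
  obtain ⟨S, -, hS⟩ := exists_subset_card_eq (s := (univ : Finset (Fin n))) (n := d) (by simpa)
  refine ⟨fun i => if i ∈ S then 1 else 0, fun i => ?_, ?_⟩
  · by_cases h : i ∈ S <;> simp [h]
  · rw [min_eq_left hd, ← hS, ← Set.ncard_coe_finset]
    congr 1
    ext i; simp

/-- A form in `Π_n^{(t)}` has total absolute mass at most `d` on a product of sign vectors, one
of which has `d` nonzero coordinates. -/
lemma sum_abs_mul_prod_le {t n : ℕ} {A : (Fin t → Fin n) → ℝ} (hA : A ∈ PiSet t n)
    {x : Fin t → Fin n → ℝ} (hx : ∀ s i, x s i = -1 ∨ x s i = 0 ∨ x s i = 1) (s : Fin t) :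
    ∑ z, |A z * ∏ j, x j (z j)| ≤ #{i | x s i ≠ 0} := by
  have hx1 : ∀ s i, |x s i| ≤ if x s i ≠ 0 then 1 else 0 := by
    intro s i
    rcases hx s i with h | h | h <;> simp [h]
  have hx2 : ∀ s i, |x s i| ≤ 1 := by
    intro s i
    rcases hx s i with h | h | h <;> simp [h]
  calc ∑ z, |A z * ∏ j, x j (z j)|
      ≤ ∑ z, |A z| * (if x s (z s) ≠ 0 then 1 else 0) := by
        refine sum_le_sum fun z _ => ?_
        rw [abs_mul, abs_prod]
        gcongr
        refine le_trans ?_ (hx1 s (z s))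
        rw [← mul_prod_erase univ _ (mem_univ s)]
        exact mul_le_of_le_one_right (abs_nonneg _)
          (prod_le_one (fun _ _ => abs_nonneg _) fun _ _ => hx2 _ _)
    _ = ∑ i with x s i ≠ 0, ∑ z, if z s = i then |A z| else 0 := by
        rw [sum_comm]
        refine sum_congr rfl fun z _ => ?_
        rw [sum_ite_eq]
        simp
    _ ≤ ∑ i with x s i ≠ 0, (1 : ℝ) := sum_le_sum fun i _ => hA.2 s i
    _ = _ := by simp

lemma sq_sub_le (a b c : ℝ) : (a - b) ^ 2 ≤ 2 * (a - c) ^ 2 + 2 * (b - c) ^ 2 := by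
  nlinarith [sq_nonneg (a - c + (b - c))]

/-- Dudley-type chaining along the nets `sparseNet t n (2 ^ l) (2 * t * M / 2 ^ l)`. -/
lemma exists_chaining_majorant {t n k M m : ℕ} (ht : 0 < t) (hn : 2 ≤ n) (hk : 0 < k)
    (hM : 0 < M) (hm : 0 < m) {A : Fin k → ((Fin t → Fin n) → ℝ)} (hA : ∀ i, A i ∈ PiSet t n)
    (L : ℕ) (hL : (2 ^ L) ^ t ≤ m) :
    ∃ G : (Fin k → Bool) → ℝ,
      (∀ ε, ∀ x : Fin t → Fin n → ℝ, (∀ s i, x s i = -1 ∨ x s i = 0 ∨ x s i = 1) →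
        (∀ s, #{i | x s i ≠ 0} ≤ M) → (∃ s, #{i | x s i ≠ 0} ≤ m) →
        ∑ i, (if ε i then (1 : ℝ) else -1) * evalForm (A i) x ≤ G ε) ∧
      𝔼 ε, G ε ≤ √(6 * t * k * m ^ 2) * √(2 * (6 * t ^ 2 * M * Real.log n / 2 ^ L)) +
        ∑ l ∈ range L, √(8 * t * k * m * (2 * 2 ^ l) ^ t) *
          √(2 * (12 * t ^ 2 * M * Real.log n / 2 ^ l)) := by
  have hlog : 0 < Real.log n := Real.log_pos (by exact_mod_cast hn)
  set N : ℕ → Finset (Fin t → Fin n → ℝ) :=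
    fun l => sparseNet t n (2 ^ l) (2 * t * M / 2 ^ l) with hN
  set vec : (Fin t → Fin n → ℝ) → Fin k → ℝ := fun y i => evalForm (A i) y with hvec
  have hNcard : ∀ l, (#(N l) : ℝ) ≤ Real.exp (6 * t ^ 2 * M * Real.log n / 2 ^ l) := by
    intro l
    refine (card_sparseNet_le hn).trans (Real.exp_le_exp.mpr ?_)
    have h : ((2 * t * M / 2 ^ l : ℕ) : ℝ) ≤ 2 * t * M / 2 ^ l := by
      refine Nat.cast_div_le.trans ?_
      push_cast; rfl
    calc (3 * t * ((2 * t * M / 2 ^ l : ℕ) : ℝ) * Real.log n)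
        ≤ 3 * t * (2 * t * M / 2 ^ l) * Real.log n := by gcongr
      _ = _ := by ring
  set V : ℕ → ℝ := fun l => 8 * t * k * m * (2 * 2 ^ l) ^ t with hV
  have hm' : (0 : ℝ) < m := by exact_mod_cast hm
  have hcoarse := exists_rademacher_majorant
    (((N L).image vec).filter fun v => ∑ i, v i ^ 2 ≤ √(6 * t * k * m ^ 2) ^ 2)
    (σ := √(6 * t * k * m ^ 2)) (Λ := 6 * t ^ 2 * M * Real.log n / 2 ^ L)
    (by positivity) (by positivity) (fun v hv => (mem_filter.mp hv).2)
    (le_trans (by exact_mod_cast (card_filter_le _ _).trans card_image_le) (hNcard L))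
  have hfine : ∀ l, ∃ G : (Fin k → Bool) → ℝ,
      (∀ ε, ∀ v ∈ ((N l ×ˢ N (l + 1)).image fun p => vec p.1 - vec p.2).filter
          (fun v => ∑ i, v i ^ 2 ≤ √(V l) ^ 2),
        ∑ i, (if ε i then (1 : ℝ) else -1) * v i ≤ G ε) ∧
      𝔼 ε, G ε ≤ √(V l) * √(2 * (12 * t ^ 2 * M * Real.log n / 2 ^ l)) := by
    intro l
    refine exists_rademacher_majorant _ (by positivity) (by positivity)
      (fun v hv => (mem_filter.mp hv).2) ?_
    calc _ ≤ (#(N l) : ℝ) * #(N (l + 1)) := by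
          exact_mod_cast (card_filter_le _ _).trans (card_image_le.trans (card_product _ _).le)
      _ ≤ Real.exp (6 * t ^ 2 * M * Real.log n / 2 ^ l) *
            Real.exp (6 * t ^ 2 * M * Real.log n / 2 ^ l) := by
          refine mul_le_mul (hNcard l) ((hNcard (l + 1)).trans (Real.exp_le_exp.mpr ?_))
            (by positivity) (by positivity)
          gcongr
          · norm_num
          · omega
      _ = _ := by rw [← Real.exp_add]; ring_nf
  obtain ⟨G₀, hG₀, hEG₀⟩ := hcoarse
  choose G hG hEG using hfine
  refine ⟨fun ε => G₀ ε + ∑ l ∈ range L, G l ε, ?_, ?_⟩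
  · rintro ε x hx hxM ⟨s, hs⟩
    have hxm : ∀ i, ∑ z, |A i z * ∏ j, x j (z j)| ≤ m := fun i =>
      (sum_abs_mul_prod_le (hA i) hx s).trans (by exact_mod_cast hs)
    have happrox : ∀ l : ℕ, ∃ y ∈ N l,
        ∑ i, (vec y i - vec x i) ^ 2 ≤ 2 * t * k * m * (2 ^ l : ℝ) ^ t ∧ (l = 0 → y = x) := by
      intro l
      rcases Nat.eq_zero_or_pos l with rfl | hl
      · refine ⟨x, ?_, ?_, fun _ => rfl⟩
        · simp only [hN, sparseNet]
          rw [Fintype.mem_piFinset]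
          intro s
          refine mem_nsmul_sparseAtoms (by omega) _ _ ?_ ?_
          · intro i
            rcases hx s i with h | h | h <;> simp [h]
          · simp only [pow_zero, Nat.div_one]
            exact (hxM s).trans (Nat.le_mul_of_pos_left _ (by omega))
        · simp; positivity
      · obtain ⟨y, hy, hy'⟩ := exists_mem_sparseNet_approx ht (by omega : 0 < n) hk
          (by positivity : 0 < 2 ^ l) hM hm' hA hx hxm hxM
        exact ⟨y, hy, by exact_mod_cast hy', fun h => absurd h hl.ne'⟩
    choose y hyN hyerr hy0 using happrox
    have hstep : ∀ l, ∑ i, (if ε i then (1 : ℝ) else -1) * (vec (y l) - vec (y (l + 1))) i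
        ≤ G l ε := by
      intro l
      refine hG l ε _ (mem_filter.mpr ⟨mem_image.mpr
        ⟨(y l, y (l + 1)), mem_product.mpr ⟨hyN l, hyN (l + 1)⟩, rfl⟩, ?_⟩)
      rw [Real.sq_sqrt (by positivity)]
      calc ∑ i, (vec (y l) - vec (y (l + 1))) i ^ 2
          ≤ ∑ i, (2 * (vec (y l) i - vec x i) ^ 2 + 2 * (vec (y (l + 1)) i - vec x i) ^ 2) :=
            sum_le_sum fun i _ => sq_sub_le _ _ _
        _ = 2 * ∑ i, (vec (y l) i - vec x i) ^ 2 + 2 * ∑ i, (vec (y (l + 1)) i - vec x i) ^ 2 := by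
            rw [sum_add_distrib, mul_sum, mul_sum]
        _ ≤ 2 * (2 * t * k * m * (2 * 2 ^ l : ℝ) ^ t) + 2 * (2 * t * k * m * (2 * 2 ^ l : ℝ) ^ t) := by
            have h1 := hyerr l
            have h2 := hyerr (l + 1)
            rw [pow_succ' (2 : ℝ) l] at h2
            have h3 : 2 * t * k * m * (2 ^ l : ℝ) ^ t ≤ 2 * t * k * m * (2 * 2 ^ l : ℝ) ^ t := by
              gcongr
              linarith [pow_pos (zero_lt_two (α := ℝ)) l]
            gcongr; linarith
        _ = V l := by rw [hV]; ring
    have hlast : ∑ i, (if ε i then (1 : ℝ) else -1) * vec (y L) i ≤ G₀ ε := by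
      refine hG₀ ε _ (mem_filter.mpr ⟨mem_image_of_mem _ (hyN L), ?_⟩)
      rw [Real.sq_sqrt (by positivity)]
      have hvx : ∑ i, vec x i ^ 2 ≤ k * (m : ℝ) ^ 2 := by
        calc ∑ i, vec x i ^ 2 ≤ ∑ _i : Fin k, (m : ℝ) ^ 2 := by
              refine sum_le_sum fun i _ => sq_le_sq' ?_ ?_
              · have := (abs_sum_le_sum_abs _ _).trans (hxm i)
                exact (abs_le.mp this).1
              · have := (abs_sum_le_sum_abs _ _).trans (hxm i)
                exact (abs_le.mp this).2
          _ = _ := by simp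
      have hL' : ((2 : ℝ) ^ L) ^ t ≤ m := by exact_mod_cast hL
      have ht' : (1 : ℝ) ≤ t := by exact_mod_cast ht
      calc ∑ i, vec (y L) i ^ 2
          ≤ ∑ i, (2 * (vec (y L) i - vec x i) ^ 2 + 2 * vec x i ^ 2) := by
            refine sum_le_sum fun i _ => ?_
            have := sq_sub_le (vec (y L) i) 0 (vec x i)
            simpa using this
        _ = 2 * ∑ i, (vec (y L) i - vec x i) ^ 2 + 2 * ∑ i, vec x i ^ 2 := by
            rw [sum_add_distrib, mul_sum, mul_sum]
        _ ≤ 2 * (2 * t * k * m * m) + 2 * (t * (k * (m : ℝ) ^ 2)) := by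
            have h1 := hyerr L
            have h2 : 2 * t * k * m * ((2 : ℝ) ^ L) ^ t ≤ 2 * t * k * m * m := by gcongr
            have h3 : k * (m : ℝ) ^ 2 ≤ t * (k * (m : ℝ) ^ 2) :=
              le_mul_of_one_le_left (by positivity) ht'
            gcongr <;> linarith
        _ = 6 * t * k * m ^ 2 := by ring
    have htele : ∑ i, (if ε i then (1 : ℝ) else -1) * vec x i
        = ∑ i, (if ε i then (1 : ℝ) else -1) * vec (y L) i
          + ∑ l ∈ range L,
            ∑ i, (if ε i then (1 : ℝ) else -1) * (vec (y l) - vec (y (l + 1))) i := by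
      rw [sum_comm, ← sum_add_distrib]
      refine sum_congr rfl fun i _ => ?_
      rw [← mul_sum]
      simp only [Pi.sub_apply]
      rw [sum_range_sub' (fun l => vec (y l) i), hy0 0 rfl]
      ring
    rw [htele]
    exact add_le_add hlast (sum_le_sum fun l _ => hstep l)
  · rw [expect_add_distrib, expect_sum_comm]
    exact add_le_add hEG₀ (sum_le_sum fun l _ => hEG l)

lemma rpow_one_sub_eq_div_sqrt {m : ℝ} (hm : 0 < m) (t : ℝ) :
    m ^ (1 - 1 / (2 * t)) = m / √(m ^ (1 / t)) := by
  rw [Real.sqrt_eq_rpow, ← Real.rpow_mul hm.le, Real.rpow_sub hm, Real.rpow_one]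
  congr 2
  rw [div_mul_div_comm]; ring

lemma sum_range_pow_le {a : ℝ} (ha : 2 ≤ a) (L : ℕ) : ∑ l ∈ range L, a ^ l ≤ a ^ L := by
  induction L with
  | zero => simp
  | succ L ih =>
    rw [sum_range_succ, pow_succ]
    nlinarith [pow_pos (zero_lt_two.trans_le ha) L]

/-- Numerical evaluation of the chaining bound at the level `L` with `2 ^ L ≈ m ^ (1 / t)`. -/
lemma chaining_bound_le {t : ℕ} (ht : 3 ≤ t) {m k M Λ : ℝ} (hm : 0 < m) (hk : 0 ≤ k) (hM : 0 ≤ M)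
    (hΛ : 0 ≤ Λ) {L : ℕ} (hL : ((2 : ℝ) ^ L) ^ t ≤ m) (hL' : m ≤ ((2 : ℝ) ^ (L + 1)) ^ t) :
    √(6 * t * k * m ^ 2) * √(2 * (6 * t ^ 2 * M * Λ / 2 ^ L)) +
        ∑ l ∈ range L, √(8 * t * k * m * (2 * 2 ^ l) ^ t) * √(2 * (12 * t ^ 2 * M * Λ / 2 ^ l))
      ≤ (√(144 * t ^ 3) + √(192 * t ^ 3 * 2 ^ t)) * √(k * M * Λ) *
        m ^ (1 - 1 / (2 * (t : ℝ))) := by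
  set u : ℝ := m ^ (1 / (t : ℝ)) with hu
  have hu0 : 0 < u := Real.rpow_pos_of_pos hm _
  have hut : u ^ t = m := by
    rw [hu, ← Real.rpow_natCast, ← Real.rpow_mul hm.le, one_div_mul_cancel, Real.rpow_one]
    exact_mod_cast (by omega : t ≠ 0)
  have h2L : (2 : ℝ) ^ L ≤ u :=
    le_of_pow_le_pow_left₀ (by omega : t ≠ 0) hu0.le (hL.trans hut.ge)
  have hu2 : u ≤ 2 * 2 ^ L := by
    rw [← pow_succ']
    exact le_of_pow_le_pow_left₀ (by omega : t ≠ 0) (by positivity) (hut.le.trans hL')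
  obtain ⟨b, rfl⟩ : ∃ b, t = b + 1 := ⟨t - 1, by omega⟩
  have hP : m ^ (1 - 1 / (2 * ((b + 1 : ℕ) : ℝ))) = √(m ^ 2 / u) := by
    rw [rpow_one_sub_eq_div_sqrt hm, Real.sqrt_div (by positivity), Real.sqrt_sq hm.le]
  rw [hP, add_mul, add_mul]
  refine add_le_add ?_ ?_
  · rw [← Real.sqrt_mul (by positivity), ← Real.sqrt_mul (by positivity),
      ← Real.sqrt_mul (by positivity)]
    refine Real.sqrt_le_sqrt ?_
    have h : 1 / (2 : ℝ) ^ L ≤ 2 / u := by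
      rw [div_le_div_iff₀ (by positivity) hu0]; linarith
    set T : ℝ := ((b + 1 : ℕ) : ℝ)
    have hT : 0 ≤ T := Nat.cast_nonneg _
    calc _ = 72 * T ^ 3 * (k * M * Λ) * m ^ 2 * (1 / 2 ^ L) := by ring
      _ ≤ 72 * T ^ 3 * (k * M * Λ) * m ^ 2 * (2 / u) := by gcongr
      _ = _ := by ring
  · set T : ℝ := ((b + 1 : ℕ) : ℝ)
    have hT : 0 ≤ T := Nat.cast_nonneg _
    set a : ℝ := √(2 ^ b) with ha
    have ha2 : 2 ≤ a := by
      refine Real.le_sqrt_of_sq_le ?_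
      exact pow_le_pow_right₀ (by norm_num) (by omega)
    have hal : ∀ l : ℕ, √((2 ^ l) ^ b) = a ^ l := by
      intro l
      rw [← pow_mul, mul_comm, pow_mul, Real.sqrt_eq_iff_eq_sq (by positivity) (by positivity),
        pow_right_comm a, ha, Real.sq_sqrt (by positivity)]
    have hterm : ∀ l : ℕ, √(8 * T * k * m * (2 * 2 ^ l) ^ (b + 1)) *
        √(2 * (12 * T ^ 2 * M * Λ / 2 ^ l))
        = √(192 * T ^ 3 * 2 ^ (b + 1)) * √(k * M * Λ) * √m * a ^ l := by
      intro l
      rw [← hal, ← Real.sqrt_mul (by positivity), ← Real.sqrt_mul (by positivity),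
        ← Real.sqrt_mul (by positivity), ← Real.sqrt_mul (by positivity)]
      congr 1
      rw [mul_pow, pow_succ ((2 : ℝ) ^ l) b]
      field_simp
      ring
    simp_rw [hterm]
    rw [← mul_sum, mul_assoc _ √m]
    gcongr
    calc √m * ∑ l ∈ range L, a ^ l ≤ √m * a ^ L := by gcongr; exact sum_range_pow_le ha2 L
      _ = √(m * (2 ^ L) ^ b) := by rw [← hal, ← Real.sqrt_mul hm.le]
      _ ≤ √(m * u ^ b) := by gcongr
      _ = √(m ^ 2 / u) := by
        congr 1
        rw [eq_div_iff hu0.ne', mul_assoc, ← pow_succ, hut, sq]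

/-- for every `t ≥ 3` there is `C(t) > 0` such that for all `n ≥ 2`,
`k ≥ 1`, `A₁,…,A_k ∈ Π_n^{(t)}` and `d ∈ [n]^t`,
`E_ε[max{(Σᵢ εᵢ Aᵢ)(x) : x_s ∈ C_{d_s}^n}] ≤ C(t) √(k max(d) log n) min(d)^{1−1/(2t)}`
(Rademacher expectation written as an average over `{−1,1}^k`; `min(d) = sInf (range d)`,
`max(d) = sSup (range d)`). -/
theorem stmt16 (t : ℕ) (ht : 3 ≤ t) :
    ∃ C : ℝ, 0 < C ∧
      ∀ (n k : ℕ), 2 ≤ n → 1 ≤ k →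
      ∀ A : Fin k → ((Fin t → Fin n) → ℝ), (∀ i, A i ∈ PiSet t n) →
      ∀ d : Fin t → ℕ, (∀ s, d s ∈ Finset.Icc 1 n) →
        ((2 : ℝ) ^ k)⁻¹ *
            ∑ ε : Fin k → Bool,
              sSup {c | ∃ x : Fin t → Fin n → ℝ,
                (∀ s, x s ∈ Cball n (d s)) ∧
                c = evalForm (∑ i, (if ε i then (1:ℝ) else -1) • A i) x}
          ≤ C * Real.sqrt ((k : ℝ) * ((sSup (Set.range d) : ℕ) : ℝ) * Real.log n) *
              ((sInf (Set.range d) : ℕ) : ℝ) ^ (1 - 1/(2*(t:ℝ))) := by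
  refine ⟨√(144 * t ^ 3) + √(192 * t ^ 3 * 2 ^ t), by positivity, ?_⟩
  intro n k hn hk A hA d hd
  have hdn : ∀ s, d s ≤ n := fun s => (mem_Icc.mp (hd s)).2
  have : Nonempty (Fin t) := ⟨⟨0, by omega⟩⟩
  set M : ℕ := sSup (Set.range d) with hMdef
  set m : ℕ := sInf (Set.range d) with hmdef
  have hdM : ∀ s, d s ≤ M := fun s => le_csSup (Set.finite_range d).bddAbove ⟨s, rfl⟩
  obtain ⟨s₀, hs₀⟩ : ∃ s, d s = m := Nat.sInf_mem (Set.range_nonempty d)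
  have hm : 0 < m := hs₀ ▸ (mem_Icc.mp (hd s₀)).1
  have hM : 0 < M := (hs₀ ▸ hm : 0 < d s₀).trans_le (hdM s₀)
  have hb : 1 < 2 ^ t := Nat.one_lt_two_pow (by omega)
  set L : ℕ := Nat.log (2 ^ t) m with hLdef
  have hL : (2 ^ L) ^ t ≤ m := by
    rw [← pow_mul, mul_comm, pow_mul]
    exact Nat.pow_log_le_self _ hm.ne'
  have hL' : m ≤ (2 ^ (L + 1)) ^ t := by
    rw [← pow_mul, mul_comm, pow_mul]
    exact (Nat.lt_pow_succ_log_self hb m).le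
  obtain ⟨G, hG, hEG⟩ := exists_chaining_majorant (by omega) hn hk hM hm hA L hL
  calc _ ≤ 𝔼 ε, G ε := by
        rw [Fintype.expect_eq_sum_div_card, inv_mul_eq_div]
        simp only [Fintype.card_pi, Fintype.card_bool, prod_const, card_univ, Fintype.card_fin,
          Nat.cast_pow, Nat.cast_ofNat]
        gcongr with ε _
        refine csSup_le ?_ ?_
        · choose x hx using fun s => Cball_nonempty (hdn s)
          exact ⟨_, x, hx, rfl⟩
        · rintro c ⟨x, hx, rfl⟩
          rw [evalForm_sum_smul]
          have hcard := fun s => card_support_of_mem_Cball (hdn s) (hx s)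
          exact hG ε x (fun s => (hx s).1) (fun s => (hcard s).trans_le (hdM s))
            ⟨s₀, ((hcard s₀).trans hs₀).le⟩
    _ ≤ _ := hEG
    _ ≤ _ := chaining_bound_le ht (by exact_mod_cast hm) (by positivity) (by positivity)
        (Real.log_natCast_nonneg n) (by exact_mod_cast hL) (by exact_mod_cast hL')
end
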